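/- Let X be a locally compact metric space and q a symmetric bilinear form on C_c(X) with q(f,f) ≥ 0 for all f ∈ C_c(X). If q is positive and local, then for all f, f', g, g' ∈ C_c(X) with f·g ≥ f'·g' pointwise one has q(f,g) ≥ q(f',g'). -/

import Mathlib

/-- The set of real-valued continuous compactly supported functions on `X`. -/
def Cc (X : Type*) [TopologicalSpace X] : Set (X → ℝ) :=
  {f | Continuous f ∧ HasCompactSupport f}

section CompactlySupported

variable {X : Type*} [TopologicalSpace X]

lemma Cc.zero_mem : (0 : X → ℝ) ∈ Cc X :=
  ⟨continuous_zero, HasCompactSupport.zero⟩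

lemma Cc.add_mem {f g : X → ℝ} (hf : f ∈ Cc X) (hg : g ∈ Cc X) : f + g ∈ Cc X :=
  ⟨hf.1.add hg.1, hf.2.add hg.2⟩

lemma Cc.mul_mem {h f : X → ℝ} (hh : Continuous h) (hf : f ∈ Cc X) : h * f ∈ Cc X :=
  ⟨hh.mul hf.1, hf.2.mul_left⟩

lemma Cc.smul_mem (c : ℝ) {f : X → ℝ} (hf : f ∈ Cc X) : c • f ∈ Cc X :=
  ⟨hf.1.const_smul c, hf.2.comp_left (g := fun y => c • y) (smul_zero c)⟩

lemma Cc.sub_mem {f g : X → ℝ} (hf : f ∈ Cc X) (hg : g ∈ Cc X) : f - g ∈ Cc X := by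
  have h := Cc.add_mem hf (Cc.smul_mem (-1) hg)
  rwa [neg_one_smul, ← sub_eq_add_neg] at h

lemma Cc.posPart_mem {f : X → ℝ} (hf : f ∈ Cc X) : (fun x => max (f x) 0) ∈ Cc X :=
  ⟨hf.1.max continuous_const, hf.2.comp_left (g := fun y => max y 0) (max_self 0)⟩

lemma Cc.sum_mem {f : ℕ → X → ℝ} (hf : ∀ k, f k ∈ Cc X) (K : ℕ) :
    ∑ k ∈ Finset.range K, f k ∈ Cc X :=
  Finset.sum_induction _ (· ∈ Cc X) (fun _ _ => Cc.add_mem) Cc.zero_mem fun k _ => hf k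

/-- A bounded continuous function admits a finite continuous partition of unity subordinate to
its level sets. -/
lemma exists_partition_levelSets {h : X → ℝ} (hh : Continuous h) {M δ : ℝ}
    (hM : ∀ x, |h x| ≤ M) (hδ : 0 < δ) :
    ∃ (K : ℕ) (ψ : ℕ → X → ℝ), (∀ k, Continuous (ψ k)) ∧ (∀ k x, 0 ≤ ψ k x) ∧
      (∀ x, ∑ k ∈ Finset.range K, ψ k x = 1) ∧
      ∀ k x y, ψ k x ≠ 0 → ψ k y ≠ 0 → |h x - h y| ≤ 2 * δ := by
  obtain ⟨N, hN⟩ := exists_nat_ge (M / δ)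
  let u : ℕ → X → ℝ := fun k x => max 0 (min 1 (h x / δ + N + 1 - k))
  have hbound : ∀ x, |h x / δ| ≤ N := fun x => by
    rw [abs_div, abs_of_pos hδ]
    exact (div_le_div_of_nonneg_right (hM x) hδ.le).trans hN
  have hsupp : ∀ k x, u k x - u (k + 1) x ≠ 0 →
      (k : ℝ) ≤ h x / δ + N + 1 ∧ h x / δ + N + 1 ≤ k + 2 := by
    intro k x hx
    by_contra hc
    apply hx
    rw [not_and_or, not_le, not_le] at hc
    simp only [u]
    push_cast
    rcases hc with hc | hc
    · rw [min_eq_right (by linarith), min_eq_right (by linarith), max_eq_left (by linarith),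
        max_eq_left (by linarith), sub_self]
    · rw [min_eq_left (by linarith), min_eq_left (by linarith), sub_self]
  refine ⟨2 * N + 1, fun k x => u k x - u (k + 1) x, fun k => ?_, fun k x => ?_, fun x => ?_,
    fun k x y hx hy => ?_⟩
  · fun_prop
  · refine sub_nonneg.2 (max_le_max le_rfl (min_le_min le_rfl ?_))
    push_cast
    linarith
  · rw [Finset.sum_range_sub' (fun k => u k x)]
    have := abs_le.1 (hbound x)
    simp only [u]
    push_cast
    rw [min_eq_left (by linarith), min_eq_right (by linarith), max_eq_right (by linarith),
      max_eq_left (by linarith), sub_zero]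
  · have h1 := hsupp k x hx
    have h2 := hsupp k y hy
    have h3 : |h x / δ - h y / δ| ≤ 2 := abs_le.2 ⟨by linarith, by linarith⟩
    rwa [← sub_div, abs_div, abs_of_pos hδ, div_le_iff₀ hδ] at h3

/-- Symmetric, positive and local bilinear forms on compactly supported functions. -/
structure IsPositiveLocalForm (q : (X → ℝ) → (X → ℝ) → ℝ) : Prop where
  symm : ∀ f ∈ Cc X, ∀ g ∈ Cc X, q f g = q g f
  add_left : ∀ f ∈ Cc X, ∀ g ∈ Cc X, ∀ h ∈ Cc X, q (f + g) h = q f h + q g h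
  smul_left : ∀ (c : ℝ), ∀ f ∈ Cc X, ∀ g ∈ Cc X, q (c • f) g = c * q f g
  nonneg : ∀ f ∈ Cc X, ∀ g ∈ Cc X, (∀ x, 0 ≤ f x) → (∀ x, 0 ≤ g x) → 0 ≤ q f g
  eq_zero : ∀ f ∈ Cc X, ∀ g ∈ Cc X, (∀ x, f x * g x = 0) → q f g = 0

namespace IsPositiveLocalForm

variable {q : (X → ℝ) → (X → ℝ) → ℝ} {f g h : X → ℝ}

lemma sub_left (hq : IsPositiveLocalForm q) (hf : f ∈ Cc X) (hg : g ∈ Cc X) (hh : h ∈ Cc X) :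
    q (f - g) h = q f h - q g h := by
  have := hq.add_left _ (Cc.sub_mem hf hg) g hg h hh
  rw [sub_add_cancel] at this
  linarith

lemma sub_right (hq : IsPositiveLocalForm q) (hf : f ∈ Cc X) (hg : g ∈ Cc X) (hh : h ∈ Cc X) :
    q f (g - h) = q f g - q f h := by
  rw [hq.symm f hf _ (Cc.sub_mem hg hh), hq.sub_left hg hh hf, hq.symm g hg f hf,
    hq.symm h hh f hf]

lemma sum_left (hq : IsPositiveLocalForm q)
    {φ : ℕ → X → ℝ} (hφ : ∀ k, φ k ∈ Cc X) (hg : g ∈ Cc X) (K : ℕ) :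
    q (∑ k ∈ Finset.range K, φ k) g = ∑ k ∈ Finset.range K, q (φ k) g := by
  induction K with
  | zero => simpa using hq.eq_zero 0 Cc.zero_mem g hg (by simp)
  | succ K ih =>
    rw [Finset.sum_range_succ, Finset.sum_range_succ,
      hq.add_left _ (Cc.sum_mem hφ K) _ (hφ K) g hg, ih]

lemma sum_sum (hq : IsPositiveLocalForm q)
    {φ γ : ℕ → X → ℝ} (hφ : ∀ k, φ k ∈ Cc X) (hγ : ∀ k, γ k ∈ Cc X) (K : ℕ) :
    q (∑ k ∈ Finset.range K, φ k) (∑ j ∈ Finset.range K, γ j) =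
      ∑ k ∈ Finset.range K, ∑ j ∈ Finset.range K, q (φ k) (γ j) := by
  rw [hq.sum_left hφ (Cc.sum_mem hγ K)]
  refine Finset.sum_congr rfl fun k _ => ?_
  rw [hq.symm _ (hφ k) _ (Cc.sum_mem hγ K), hq.sum_left hγ (hφ k)]
  exact Finset.sum_congr rfl fun j _ => hq.symm _ (hγ j) _ (hφ k)

lemma mono_left (hq : IsPositiveLocalForm q)
    (hf : f ∈ Cc X) (hg : g ∈ Cc X) (hh : h ∈ Cc X) (hfg : ∀ x, f x ≤ g x)
    (h0 : ∀ x, 0 ≤ h x) : q f h ≤ q g h := by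
  have := hq.nonneg _ (Cc.sub_mem hg hf) h hh (fun x => sub_nonneg.2 (hfg x)) h0
  rw [hq.sub_left hg hf hh] at this
  linarith

/-- If `h` is within `ε` of a constant wherever `f` or `g` is nonzero, then moving `h` between the
arguments changes the form by at most `2 * ε * q f g`. -/
lemma mul_left_le_of_near_const (hq : IsPositiveLocalForm q)
    (hh : Continuous h) (hf : f ∈ Cc X) (hg : g ∈ Cc X)
    (f0 : ∀ x, 0 ≤ f x) (g0 : ∀ x, 0 ≤ g x) {c ε : ℝ}
    (hcf : ∀ x, f x ≠ 0 → |h x - c| ≤ ε) (hcg : ∀ x, g x ≠ 0 → |h x - c| ≤ ε) :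
    q (h * f) g ≤ q f (h * g) + 2 * ε * q f g := by
  have h1 : q (h * f) g ≤ (c + ε) * q f g := by
    rw [← hq.smul_left _ f hf g hg]
    refine hq.mono_left (Cc.mul_mem hh hf) (Cc.smul_mem _ hf) hg (fun x => ?_) g0
    rcases eq_or_ne (f x) 0 with hx | hx
    · simp [hx]
    · exact mul_le_mul_of_nonneg_right (by linarith [(abs_le.1 (hcf x hx)).2]) (f0 x)
  have h2 : (c - ε) * q f g ≤ q f (h * g) := by
    rw [hq.symm f hf g hg, hq.symm f hf _ (Cc.mul_mem hh hg), ← hq.smul_left _ g hg f hf]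
    refine hq.mono_left (Cc.smul_mem _ hg) (Cc.mul_mem hh hg) hf (fun x => ?_) f0
    rcases eq_or_ne (g x) 0 with hx | hx
    · simp [hx]
    · exact mul_le_mul_of_nonneg_right (by linarith [(abs_le.1 (hcg x hx)).1]) (g0 x)
  linarith

lemma mul_left_le (hq : IsPositiveLocalForm q)
    {M : ℝ} (hh : Continuous h) (hM : ∀ x, |h x| ≤ M) (hf : f ∈ Cc X)
    (hg : g ∈ Cc X) (f0 : ∀ x, 0 ≤ f x) (g0 : ∀ x, 0 ≤ g x) :
    q (h * f) g ≤ q f (h * g) := by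
  have approx : ∀ δ > 0, q (h * f) g ≤ q f (h * g) + 2 * (2 * δ) * q f g := by
    intro δ hδ
    obtain ⟨K, ψ, ψc, ψ0, ψ1, ψh⟩ := exists_partition_levelSets hh hM hδ
    have hsum : ∀ v : X → ℝ, ∑ k ∈ Finset.range K, ψ k * v = v := fun v => by
      ext x
      simp [← Finset.sum_mul, ψ1]
    have hsum' : ∀ v : X → ℝ, ∑ k ∈ Finset.range K, h * (ψ k * v) = h * v := fun v => by
      rw [← Finset.mul_sum, hsum]
    have mf := fun k => Cc.mul_mem (ψc k) hf
    have mg := fun k => Cc.mul_mem (ψc k) hg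
    have e1 := hq.sum_sum (fun k => Cc.mul_mem hh (mf k)) mg K
    have e2 := hq.sum_sum mf (fun k => Cc.mul_mem hh (mg k)) K
    have e3 := hq.sum_sum mf mg K
    rw [hsum', hsum] at e1
    rw [hsum', hsum] at e2
    rw [hsum, hsum] at e3
    rw [e1, e2, e3]
    simp only [Finset.mul_sum, ← Finset.sum_add_distrib]
    refine Finset.sum_le_sum fun k _ => Finset.sum_le_sum fun j _ => ?_
    by_cases hkj : ∃ y, ψ k y ≠ 0 ∧ ψ j y ≠ 0
    · obtain ⟨y, hk, hj⟩ := hkj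
      exact hq.mul_left_le_of_near_const (c := h y) hh (mf k) (mg j)
        (fun x => mul_nonneg (ψ0 k x) (f0 x)) (fun x => mul_nonneg (ψ0 j x) (g0 x))
        (fun x hx => ψh k x y (left_ne_zero_of_mul hx) hk)
        (fun x hx => ψh j x y (left_ne_zero_of_mul hx) hj)
    · have hz : ∀ x, ψ k x = 0 ∨ ψ j x = 0 := fun x => by
        by_contra hc
        exact hkj ⟨x, not_or.1 hc⟩
      rw [hq.eq_zero _ (Cc.mul_mem hh (mf k)) _ (mg j)
          fun x => by rcases hz x with hx | hx <;> simp [hx],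
        hq.eq_zero _ (mf k) _ (Cc.mul_mem hh (mg j))
          fun x => by rcases hz x with hx | hx <;> simp [hx],
        hq.eq_zero _ (mf k) _ (mg j) fun x => by rcases hz x with hx | hx <;> simp [hx]]
      simp
  have hfg := hq.nonneg f hf g hg f0 g0
  refine le_of_forall_pos_le_add fun ε hε => (approx (ε / (4 * (q f g + 1))) (by positivity)).trans
    (add_le_add le_rfl ?_)
  rw [show 2 * (2 * (ε / (4 * (q f g + 1)))) * q f g = ε * (q f g / (q f g + 1)) by
    field_simp; ring]
  exact mul_le_of_le_one_right hε.le ((div_le_one (by positivity)).2 (by linarith))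

lemma mul_left_eq_of_nonneg (hq : IsPositiveLocalForm q)
    {M : ℝ} (hh : Continuous h) (hM : ∀ x, |h x| ≤ M) (hf : f ∈ Cc X)
    (hg : g ∈ Cc X) (f0 : ∀ x, 0 ≤ f x) (g0 : ∀ x, 0 ≤ g x) :
    q (h * f) g = q f (h * g) := by
  refine le_antisymm (hq.mul_left_le hh hM hf hg f0 g0) ?_
  rw [hq.symm f hf _ (Cc.mul_mem hh hg), hq.symm _ (Cc.mul_mem hh hf) g hg]
  exact hq.mul_left_le hh hM hg hf g0 f0

lemma mul_left_eq (hq : IsPositiveLocalForm q)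
    {M : ℝ} (hh : Continuous h) (hM : ∀ x, |h x| ≤ M) (hf : f ∈ Cc X)
    (hg : g ∈ Cc X) (f0 : ∀ x, 0 ≤ f x) : q (h * f) g = q f (h * g) := by
  have hp := Cc.posPart_mem hg
  have hn : (fun x => max (g x) 0) - g ∈ Cc X := Cc.sub_mem hp hg
  have hn0 : ∀ x, 0 ≤ ((fun x => max (g x) 0) - g) x := fun x => sub_nonneg.2 (le_max_left _ _)
  have e1 := hq.mul_left_eq_of_nonneg hh hM hf hp f0 fun x => le_max_right _ _
  have e2 := hq.mul_left_eq_of_nonneg hh hM hf hn f0 hn0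
  rw [mul_sub, hq.sub_right (Cc.mul_mem hh hf) hp hg,
    hq.sub_right hf (Cc.mul_mem hh hp) (Cc.mul_mem hh hg)] at e2
  linarith

/-- The form only depends on the product of its arguments. -/
lemma eq_apply_mul (hq : IsPositiveLocalForm q)
    {χ : X → ℝ} (hχ : χ ∈ Cc X) (χ0 : ∀ x, 0 ≤ χ x) (hf : f ∈ Cc X)
    (hg : g ∈ Cc X) (h1 : ∀ x ∈ tsupport f, χ x = 1) : q f g = q χ (f * g) := by
  obtain ⟨M, hM⟩ := hf.1.bounded_above_of_compact_support hf.2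
  rw [← hq.mul_left_eq hf.1 hM hχ hg χ0]
  congr 1
  ext x
  by_cases hx : x ∈ tsupport f
  · simp [h1 x hx]
  · simp [image_eq_zero_of_notMem_tsupport hx]

end IsPositiveLocalForm

end CompactlySupported

/-- Let X be a locally compact metric space and q a symmetric
bilinear form on C_c(X) with q(f,f) ≥ 0. If q is positive and local, then
f·g ≥ f'·g' pointwise implies q(f,g) ≥ q(f',g'). -/
theorem positive_local_implies_product_monotone
    {X : Type*} [MetricSpace X] [LocallyCompactSpace X]
    (q : (X → ℝ) → (X → ℝ) → ℝ)
    (hq_symm : ∀ f ∈ Cc X, ∀ g ∈ Cc X, q f g = q g f)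
    (hq_add : ∀ f ∈ Cc X, ∀ g ∈ Cc X, ∀ h ∈ Cc X, q (f + g) h = q f h + q g h)
    (hq_smul : ∀ (c : ℝ), ∀ f ∈ Cc X, ∀ g ∈ Cc X, q (c • f) g = c * q f g)
    (hq_nonneg : ∀ f ∈ Cc X, 0 ≤ q f f)
    (hq_pos : ∀ f ∈ Cc X, ∀ g ∈ Cc X, (∀ x, 0 ≤ f x) → (∀ x, 0 ≤ g x) → 0 ≤ q f g)
    (hq_loc : ∀ f ∈ Cc X, ∀ g ∈ Cc X, (∀ x, f x * g x = 0) → q f g = 0) :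
    ∀ f ∈ Cc X, ∀ f' ∈ Cc X, ∀ g ∈ Cc X, ∀ g' ∈ Cc X,
      (∀ x, f' x * g' x ≤ f x * g x) → q f' g' ≤ q f g := by
  intro f hf f' hf' g hg g' hg' hle
  have hq : IsPositiveLocalForm q := ⟨hq_symm, hq_add, hq_smul, hq_pos, hq_loc⟩
  obtain ⟨χ, χ1, -, χc, χ01⟩ := exists_continuous_one_zero_of_isCompact
    (hf.2.isCompact.union hf'.2.isCompact) isClosed_empty (Set.disjoint_empty _)
  have hχ : (χ : X → ℝ) ∈ Cc X := ⟨χ.continuous, χc⟩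
  have χ0 : ∀ x, 0 ≤ χ x := fun x => (χ01 x).1
  have hm := Cc.mul_mem hf.1 hg
  have hm' := Cc.mul_mem hf'.1 hg'
  rw [hq.eq_apply_mul hχ χ0 hf hg fun x hx => χ1 (Or.inl hx),
    hq.eq_apply_mul hχ χ0 hf' hg' fun x hx => χ1 (Or.inr hx),
    hq.symm _ hχ _ hm, hq.symm _ hχ _ hm']
  exact hq.mono_left hm' hm hχ hle χ0
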